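/- arXiv:1801.06539 — 10 statements merged into one kernel-verified Lean document; each statement's English description precedes it below -/
import Mathlib

section
/- Let (g, [·,·], α_g) be a hom-Lie algebra over a field K and let (ρ, ψ, V) be a representation of g on a K-vector space V with respect to ψ. Then the direct sum g ⊕ V carries a hom-Lie algebra structure with bracket [(x,u),(y,v)] := ([x,y]_g, ρ(x)v − ρ(y)u) and structure map (α_g ⊕ ψ)(x,u) := (α_g(x), ψ(u)); that is, this bracket is bilinear and skew-symmetric, (α_g ⊕ ψ)([(x,u),(y,v)]) = [(α_g ⊕ ψ)(x,u), (α_g ⊕ ψ)(y,v)], and the twisted Jacobi identity [(α_g ⊕ ψ)(x,u),[(y,v),(z,w)]] + [(α_g ⊕ ψ)(y,v),[(z,w),(x,u)]] + [(α_g ⊕ ψ)(z,w),[(x,u),(y,v)]] = 0 holds for all x,y,z ∈ g and u,v,w ∈ V. -/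
/-- A hom-Lie algebra structure on a `K`-vector space `g`: a bilinear bracket `br`
which is skew-symmetric, a structure map `α` which is multiplicative for the bracket,
and the twisted Jacobi identity. -/
def IsHomLie (K : Type*) [Field K] {g : Type*} [AddCommGroup g] [Module K g]
    (br : g →ₗ[K] g →ₗ[K] g) (α : g →ₗ[K] g) : Prop :=
  (∀ x y, br x y = - br y x) ∧
  (∀ x y, α (br x y) = br (α x) (α y)) ∧
  (∀ x y z, br (α x) (br y z) + br (α y) (br z x) + br (α z) (br x y) = 0)

/-- A representation `ρ` of a hom-Lie algebra `(g, br, α)` on `V` with respect to `ψ`. -/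
def IsHomLieRep (K : Type*) [Field K] {g V : Type*} [AddCommGroup g] [Module K g]
    [AddCommGroup V] [Module K V]
    (br : g →ₗ[K] g →ₗ[K] g) (α : g →ₗ[K] g)
    (ρ : g →ₗ[K] Module.End K V) (ψ : V →ₗ[K] V) : Prop :=
  (∀ x, ρ (α x) ∘ₗ ψ = ψ ∘ₗ ρ x) ∧
  (∀ x y, ρ (br x y) ∘ₗ ψ = ρ (α x) ∘ₗ ρ y - ρ (α y) ∘ₗ ρ x)

/-- The bracket `((x, u), (y, v)) ↦ (br x y, ρ x v - ρ y u)` on `g × V`. -/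
def semidirectBracket {K g V : Type*} [Field K] [AddCommGroup g] [Module K g]
    [AddCommGroup V] [Module K V] (br : g →ₗ[K] g →ₗ[K] g) (ρ : g →ₗ[K] Module.End K V) :
    (g × V) →ₗ[K] (g × V) →ₗ[K] (g × V) :=
  LinearMap.mk₂ K (fun p q => (br p.1 q.1, ρ p.1 q.2 - ρ q.1 p.2))
    (fun p p' q => by ext <;> simp; abel)
    (fun c p q => by ext <;> simp [smul_sub])
    (fun p q q' => by ext <;> simp; abel)
    (fun c p q => by ext <;> simp [smul_sub])

theorem semidirectBracket_apply {K g V : Type*} [Field K] [AddCommGroup g] [Module K g]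
    [AddCommGroup V] [Module K V] (br : g →ₗ[K] g →ₗ[K] g) (ρ : g →ₗ[K] Module.End K V)
    (p q : g × V) :
    semidirectBracket br ρ p q = (br p.1 q.1, ρ p.1 q.2 - ρ q.1 p.2) :=
  rfl

/-- a representation of a hom-Lie algebra yields a semidirect-sum
hom-Lie algebra structure on `g ⊕ V`. -/
theorem homLie_semidirect_sum (K : Type*) [Field K] {g V : Type*}
    [AddCommGroup g] [Module K g] [AddCommGroup V] [Module K V]
    (br : g →ₗ[K] g →ₗ[K] g) (α : g →ₗ[K] g)
    (ρ : g →ₗ[K] Module.End K V) (ψ : V →ₗ[K] V)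
    (hg : IsHomLie K br α) (hρ : IsHomLieRep K br α ρ ψ) :
    ∃ B : (g × V) →ₗ[K] (g × V) →ₗ[K] (g × V),
      (∀ (x y : g) (u v : V), B (x, u) (y, v) = (br x y, ρ x v - ρ y u)) ∧
      IsHomLie K B (α.prodMap ψ) := by
  obtain ⟨skew, mult, jacobi⟩ := hg
  obtain ⟨equivariant, compat⟩ := hρ
  have equivariant_apply : ∀ x u, ρ (α x) (ψ u) = ψ (ρ x u) :=
    fun x => LinearMap.congr_fun (equivariant x)
  have compat_apply : ∀ x y u, ρ (br x y) (ψ u) = ρ (α x) (ρ y u) - ρ (α y) (ρ x u) :=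
    fun x y => LinearMap.congr_fun (compat x y)
  refine ⟨semidirectBracket br ρ, fun _ _ _ _ => rfl, ?_, ?_, ?_⟩
  · rintro ⟨x, u⟩ ⟨y, v⟩
    simp [semidirectBracket_apply, ← skew x y]
  · rintro ⟨x, u⟩ ⟨y, v⟩
    simp [semidirectBracket_apply, mult, equivariant_apply]
  · rintro ⟨x, u⟩ ⟨y, v⟩ ⟨z, w⟩
    simp only [semidirectBracket_apply, LinearMap.prodMap_apply, Prod.mk_add_mk,
      Prod.mk_eq_zero, jacobi, compat_apply, map_sub, true_and]
    abel
end

section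
/- Let (A, μ, α) be a hom-center-symmetric algebra over a field K. Then the commutator [x,y] := μ(x,y) − μ(y,x) together with α defines a hom-Lie algebra structure on A: [·,·] is bilinear and skew-symmetric, α([x,y]) = [α(x), α(y)], and [α(x),[y,z]] + [α(y),[z,x]] + [α(z),[x,y]] = 0 for all x, y, z ∈ A. -/
/-- A hom-center-symmetric algebra structure on a `K`-vector space `A`:
a bilinear product `μ`, a linear structure map `α` which is multiplicative for `μ`,
such that the `α`-associator `(x,y,z) = μ(μ(x,y), α z) - μ(α x, μ(y,z))` is
center-symmetric: `(x,y,z) = (z,y,x)`. -/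
def IsHCS (K : Type*) [Field K] {A : Type*} [AddCommGroup A] [Module K A]
    (μ : A →ₗ[K] A →ₗ[K] A) (α : A →ₗ[K] A) : Prop :=
  (∀ x y, α (μ x y) = μ (α x) (α y)) ∧
  (∀ x y z, μ (μ x y) (α z) - μ (α x) (μ y z) = μ (μ z y) (α x) - μ (α z) (μ y x))

/-- the commutator of a hom-center-symmetric algebra, together with `α`,
is a hom-Lie algebra structure. -/
theorem hcs_commutator_isHomLie (K : Type*) [Field K] {A : Type*}
    [AddCommGroup A] [Module K A]
    (μ : A →ₗ[K] A →ₗ[K] A) (α : A →ₗ[K] A) (h : IsHCS K μ α) :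
    (∀ x y : A, (μ - μ.flip) x y = μ x y - μ y x) ∧
    IsHomLie K (μ - μ.flip) α := by
  obtain ⟨hmul, hassoc⟩ := h
  refine ⟨fun x y => by simp, fun x y => by simp, fun x y => by simp [hmul], fun x y z => ?_⟩
  have hxyz := hassoc x y z
  have hyzx := hassoc y z x
  have hzxy := hassoc z x y
  simp only [LinearMap.sub_apply, LinearMap.flip_apply, map_sub]
  linear_combination (norm := abel) -hxyz - hyzx - hzxy
end

section
/- Let (A, μ, α) be a hom-center-symmetric algebra over a field K, and define ad_x := L_x − R_x where L_x(y) := μ(x,y) and R_x(y) := μ(y,x). Then (ad, α) is a representation of the sub-adjacent hom-Lie algebra G(A)_α on A with respect to α: for all x, y ∈ A, ad_{α(x)} ∘ α = α ∘ ad_x and ad_{[x,y]} ∘ α = ad_{α(x)} ∘ ad_y − ad_{α(y)} ∘ ad_x, where [x,y] := μ(x,y) − μ(y,x). -/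
/-- for a hom-center-symmetric algebra `(A, μ, α)`, the adjoint map
`ad = L - R = μ - μ.flip` together with `α` is a representation of the sub-adjacent
hom-Lie algebra `G(A)_α` (whose bracket is `μ - μ.flip`) on `A` with respect to `α`. -/
theorem hcs_adjoint_is_rep (K : Type*) [Field K] {A : Type*}
    [AddCommGroup A] [Module K A]
    (μ : A →ₗ[K] A →ₗ[K] A) (α : A →ₗ[K] A) (h : IsHCS K μ α) :
    IsHomLieRep K (μ - μ.flip) α (μ - μ.flip) α := by
  obtain ⟨hmul, hassoc⟩ := h
  refine ⟨fun x => ?_, fun x y => ?_⟩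
  · ext y
    simp [hmul]
  · ext z
    simp only [LinearMap.comp_apply, LinearMap.sub_apply, LinearMap.flip_apply, map_sub]
    have hsum := congrArg₂ (· + ·) (congrArg₂ (· + ·) (hassoc x y z) (hassoc y z x)) (hassoc z x y)
    rw [← sub_eq_zero] at hsum ⊢
    rw [← hsum]
    abel
end

section
/- Let (A, μ, α) be a hom-center-symmetric algebra over a field K, V a K-vector space, l, r : A → End(V) linear maps, and φ : V → V a linear map. Then (l, r, φ, V) is a bimodule of (A, μ, α) if and only if the direct sum A ⊕ V is a hom-center-symmetric algebra with product (x+u) ∗ (y+v) := μ(x,y) + l(x)v + r(y)u and structure map (α ⊕ φ)(x+u) := α(x) + φ(u). -/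
/-- A bimodule `(l, r, φ, V)` of a hom-center-symmetric algebra `(A, μ, α)`. -/
def IsBimodule (K : Type*) [Field K] {A V : Type*} [AddCommGroup A] [Module K A]
    [AddCommGroup V] [Module K V]
    (μ : A →ₗ[K] A →ₗ[K] A) (α : A →ₗ[K] A)
    (l r : A →ₗ[K] Module.End K V) (φ : V →ₗ[K] V) : Prop :=
  (∀ x, φ ∘ₗ l x = l (α x) ∘ₗ φ) ∧
  (∀ x, φ ∘ₗ r x = r (α x) ∘ₗ φ) ∧
  (∀ x y, l (α x) ∘ₗ l y - l (μ x y) ∘ₗ φ = r (μ y x) ∘ₗ φ - r (α x) ∘ₗ r y) ∧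
  (∀ x y, l (α x) ∘ₗ r y - r (α y) ∘ₗ l x = l (α y) ∘ₗ r x - r (α x) ∘ₗ l y)

/-- The semidirect product `(x+u) ∗ (y+v) := μ(x,y) + l(x)v + r(y)u` on `A ⊕ V`. -/
noncomputable def semidirectMul (K : Type*) [Field K] {A V : Type*}
    [AddCommGroup A] [Module K A] [AddCommGroup V] [Module K V]
    (μ : A →ₗ[K] A →ₗ[K] A) (l r : A →ₗ[K] Module.End K V) :
    (A × V) →ₗ[K] (A × V) →ₗ[K] (A × V) :=
  LinearMap.mk₂ K (fun p q => (μ p.1 q.1, l p.1 q.2 + r q.1 p.2))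
    (fun p p' q => by simp [Prod.ext_iff, map_add, LinearMap.add_apply]; abel)
    (fun c p q => by simp [Prod.ext_iff, map_smul, LinearMap.smul_apply, smul_add])
    (fun p q q' => by simp [Prod.ext_iff, map_add, LinearMap.add_apply]; abel)
    (fun c p q => by simp [Prod.ext_iff, map_smul, LinearMap.smul_apply, smul_add])

@[simp]
theorem semidirectMul_apply (K : Type*) [Field K] {A V : Type*}
    [AddCommGroup A] [Module K A] [AddCommGroup V] [Module K V]
    (μ : A →ₗ[K] A →ₗ[K] A) (l r : A →ₗ[K] Module.End K V) (p q : A × V) :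
    semidirectMul K μ l r p q = (μ p.1 q.1, l p.1 q.2 + r q.1 p.2) := rfl

/-- `(l, r, φ, V)` is a bimodule of the hom-center-symmetric algebra
`(A, μ, α)` iff `A ⊕ V` with the semidirect product and structure map `α ⊕ φ` is a
hom-center-symmetric algebra. -/
theorem bimodule_iff_semidirect_hcs (K : Type*) [Field K] {A V : Type*}
    [AddCommGroup A] [Module K A] [AddCommGroup V] [Module K V]
    (μ : A →ₗ[K] A →ₗ[K] A) (α : A →ₗ[K] A)
    (l r : A →ₗ[K] Module.End K V) (φ : V →ₗ[K] V) (h : IsHCS K μ α) :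
    IsBimodule K μ α l r φ ↔ IsHCS K (semidirectMul K μ l r) (α.prodMap φ) := by
  obtain ⟨hα, hμ⟩ := h
  constructor
  · rintro ⟨hl, hr, hlr, hm⟩
    simp only [LinearMap.ext_iff, LinearMap.comp_apply, LinearMap.sub_apply] at hl hr hlr hm
    refine ⟨?_, ?_⟩
    · rintro ⟨x, u⟩ ⟨y, v⟩
      simp [hα, hl, hr]
    · rintro ⟨x, u⟩ ⟨y, v⟩ ⟨z, w⟩
      refine Prod.ext (by simpa using hμ x y z) ?_
      have hw := hlr x y w
      have hu := hlr z y u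
      have hv := hm x z v
      simp only [semidirectMul_apply, LinearMap.prodMap_apply, Prod.snd_sub, map_add]
      linear_combination (norm := module) hu - hw - hv
  · rintro ⟨hφ, hassoc⟩
    refine ⟨fun x => ?_, fun x => ?_, fun x y => ?_, fun x y => ?_⟩ <;> ext v
    · simpa using congrArg Prod.snd (hφ (x, 0) (0, v))
    · simpa using congrArg Prod.snd (hφ (0, v) (x, 0))
    · have hw := congrArg Prod.snd (hassoc (x, 0) (y, 0) (0, v))
      simp at hw ⊢
      linear_combination (norm := module) -hw
    · have hv := congrArg Prod.snd (hassoc (x, 0) (0, v) (y, 0))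
      simp at hv ⊢
      linear_combination (norm := module) -hv
end

section
/- Let (l, r, φ, V) be a bimodule of a hom-center-symmetric algebra (A, μ, α) over a field K. Then (l − r, φ) is a representation of the sub-adjacent hom-Lie algebra G(A)_α on V with respect to φ: for all x, y ∈ A, (l−r)(α(x)) ∘ φ = φ ∘ (l−r)(x) and (l−r)([x,y]) ∘ φ = (l−r)(α(x)) ∘ (l−r)(y) − (l−r)(α(y)) ∘ (l−r)(x), where [x,y] := μ(x,y) − μ(y,x). -/
/-- for a bimodule `(l, r, φ, V)` of a hom-center-symmetric algebra
`(A, μ, α)`, the pair `(l - r, φ)` is a representation of the sub-adjacent hom-Lie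
algebra (with bracket `μ - μ.flip`) on `V` with respect to `φ`. -/
theorem bimodule_sub_is_homLieRep (K : Type*) [Field K] {A V : Type*}
    [AddCommGroup A] [Module K A] [AddCommGroup V] [Module K V]
    (μ : A →ₗ[K] A →ₗ[K] A) (α : A →ₗ[K] A)
    (l r : A →ₗ[K] Module.End K V) (φ : V →ₗ[K] V)
    (h : IsHCS K μ α) (hb : IsBimodule K μ α l r φ) :
    IsHomLieRep K (μ - μ.flip) α (l - r) φ := by
  obtain ⟨hl, hr, hassoc, hcross⟩ := hb
  refine ⟨fun x => ?_, fun x y => ?_⟩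
  · simp only [LinearMap.sub_apply, LinearMap.sub_comp, LinearMap.comp_sub, hl, hr]
  · have hxy := hassoc x y
    have hyx := hassoc y x
    have hc := hcross x y
    simp only [LinearMap.sub_apply, LinearMap.flip_apply, map_sub, LinearMap.sub_comp,
      LinearMap.comp_sub]
    linear_combination (norm := abel) hyx - hxy + hc
end

section
/- Let (A, μ, α) be a hom-center-symmetric algebra over a field K, V a finite-dimensional K-vector space, l, r : A → End(V) linear maps, and φ : V → V a linear map. Assume α ∘ α = id_A. Then (l, r, φ, V) is a bimodule of (A, μ, α) if and only if (r*, l*, φ*, V*) is a bimodule of (A, μ, α), where V* is the dual space of V and for a linear map T : V → V, T* : V* → V* denotes its transpose, ⟨T*(f), v⟩ = ⟨f, T(v)⟩, and r*(x) := (r(x))*, l*(x) := (l(x))*. -/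
theorem LinearMap.dualMap_inj {K V W : Type*} [Field K] [AddCommGroup V] [Module K V]
    [AddCommGroup W] [Module K W] {f g : V →ₗ[K] W} : f.dualMap = g.dualMap ↔ f = g := by
  refine ⟨fun h => LinearMap.ext fun v => ?_, congrArg _⟩
  rw [← sub_eq_zero, ← Module.forall_dual_apply_eq_zero_iff K]
  intro ξ
  rw [map_sub, sub_eq_zero]
  exact LinearMap.congr_fun (LinearMap.congr_fun h ξ) v

/-- The bimodule axioms for the transposed data, written on the original space. -/
theorem isBimodule_transpose_iff {K A V : Type*} [Field K]
    [AddCommGroup A] [Module K A] [AddCommGroup V] [Module K V]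
    (μ : A →ₗ[K] A →ₗ[K] A) (α : A →ₗ[K] A)
    (l r : A →ₗ[K] Module.End K V) (φ : V →ₗ[K] V) :
    IsBimodule K μ α
        ((Module.Dual.transpose (R := K) (M := V) (M' := V)) ∘ₗ r)
        ((Module.Dual.transpose (R := K) (M := V) (M' := V)) ∘ₗ l)
        φ.dualMap ↔
      (∀ x, r x ∘ₗ φ = φ ∘ₗ r (α x)) ∧
      (∀ x, l x ∘ₗ φ = φ ∘ₗ l (α x)) ∧
      (∀ x y, r y ∘ₗ r (α x) - φ ∘ₗ r (μ x y) = φ ∘ₗ l (μ y x) - l y ∘ₗ l (α x)) ∧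
      (∀ x y, l y ∘ₗ r (α x) - r x ∘ₗ l (α y) = l x ∘ₗ r (α y) - r y ∘ₗ l (α x)) := by
  have dualMap_sub (f g : V →ₗ[K] V) : (f - g).dualMap = f.dualMap - g.dualMap :=
    map_sub (Module.Dual.transpose (R := K)) f g
  simp only [← LinearMap.dualMap_inj (V := V) (W := V), dualMap_sub,
    ← LinearMap.dualMap_comp_dualMap]
  rfl

/-- for a hom-center-symmetric algebra `(A, μ, α)` with `α ∘ α = id`
and a finite-dimensional space `V`, `(l, r, φ, V)` is a bimodule iff the dual data
`(r*, l*, φ*, V*)` is a bimodule, where `*` denotes the transpose. -/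
theorem bimodule_dual_iff (K : Type*) [Field K] {A V : Type*}
    [AddCommGroup A] [Module K A] [AddCommGroup V] [Module K V]
    [FiniteDimensional K V]
    (μ : A →ₗ[K] A →ₗ[K] A) (α : A →ₗ[K] A)
    (l r : A →ₗ[K] Module.End K V) (φ : V →ₗ[K] V)
    (h : IsHCS K μ α) (hα : α ∘ₗ α = LinearMap.id) :
    IsBimodule K μ α l r φ ↔
      IsBimodule K μ α
        ((Module.Dual.transpose (R := K) (M := V) (M' := V)) ∘ₗ r)
        ((Module.Dual.transpose (R := K) (M := V) (M' := V)) ∘ₗ l)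
        φ.dualMap := by
  obtain ⟨hμ, -⟩ := h
  have hαα (x : A) : α (α x) = x := LinearMap.congr_fun hα x
  rw [isBimodule_transpose_iff]
  constructor
  · rintro ⟨hl, hr, hlr, hc⟩
    refine ⟨fun x => ?_, fun x => ?_, fun x y => ?_, fun x y => ?_⟩
    · rw [hr, hαα]
    · rw [hl, hαα]
    · have e := hlr (α y) (α x)
      rw [hαα, ← hμ, ← hμ, ← hl, ← hr, sub_eq_sub_iff_add_eq_add] at e
      rw [sub_eq_sub_iff_add_eq_add, add_comm, e, add_comm]
    · have e := hc (α x) (α y)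
      rw [hαα, hαα] at e
      exact e.symm
  · rintro ⟨hr, hl, hlr, hc⟩
    refine ⟨fun x => ?_, fun x => ?_, fun x y => ?_, fun x y => ?_⟩
    · rw [hl, hαα]
    · rw [hr, hαα]
    · have e := hlr (α y) (α x)
      rw [hαα, ← hμ, ← hμ, ← hl, ← hr, sub_eq_sub_iff_add_eq_add] at e
      rw [sub_eq_sub_iff_add_eq_add, add_comm, e, add_comm]
    · have e := hc (α x) (α y)
      rw [hαα, hαα] at e
      exact e.symm
end

section
/- Let (A, μ_A, α_A) and (B, μ_B, α_B) be hom-center-symmetric algebras over a field K, and let l_A, r_A : A → End(B) and l_B, r_B : B → End(A) be linear maps such that (l_A, r_A, α_B, B) is a bimodule of (A, μ_A, α_A) and (l_B, r_B, α_A, A) is a bimodule of (B, μ_B, α_B). Then A ⊕ B with the product (x+a) ∗ (y+b) := (μ_A(x,y) + l_B(a)y + r_B(b)x) + (μ_B(a,b) + l_A(x)b + r_A(y)a) and structure map α_A ⊕ α_B is a hom-center-symmetric algebra if and only if for all x, y ∈ A and a, b ∈ B the four compatibility conditions (M1)–(M4) hold: (M1) μ_A(l_B(a)x, α_A(y)) +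 l_B(r_A(x)a)(α_A(y)) − l_B(α_B(a))(μ_A(x,y)) − r_B(α_B(a))(μ_A(y,x)) + μ_A(α_A(y), r_B(a)x) + r_B(l_A(x)a)(α_A(y)) = 0; (M2) μ_A(r_B(a)x, α_A(y)) + l_B(l_A(x)a)(α_A(y)) − μ_A(α_A(x), l_B(a)y) − r_B(r_A(y)a)(α_A(x)) − μ_A(r_B(a)y, α_A(x)) − l_B(l_A(y)a)(α_A(x)) + μ_A(α_A(y), l_B(a)x) + r_B(r_A(x)a)(α_A(y)) = 0; (M3) μ_B(l_A(x)a, α_B(b)) + l_A(r_B(a)x)(α_B(b)) − l_A(α_A(x))(μ_B(a,b)) − r_A(α_A(x))(μ_B(b,a)) + μ_B(α_B(b), r_A(x)a) + r_A(l_B(a)x)(α_B(b)) = 0; (M4) μ_B(r_A(x)a, α_B(b)) + l_A(l_B(a)x)(α_B(b)) − μ_B(α_B(a), l_A(x)b) − r_A(r_B(b)x)(α_B(a)) − μ_B(r_A(x)b, α_B(a)) − l_A(l_B(b)x)(α_B(a)) + μ_B(α_B(b), l_A(x)a) + r_A(r_B(a)x)(α_B(b)) = 0. -/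
/-- The product `(x+a) ∗ (y+b) := (μA(x,y) + lB(a)y + rB(b)x) + (μB(a,b) + lA(x)b + rA(y)a)`
on `A ⊕ B`. -/
noncomputable def mpMul (K : Type*) [Field K] {A B : Type*}
    [AddCommGroup A] [Module K A] [AddCommGroup B] [Module K B]
    (μA : A →ₗ[K] A →ₗ[K] A) (μB : B →ₗ[K] B →ₗ[K] B)
    (lA rA : A →ₗ[K] Module.End K B) (lB rB : B →ₗ[K] Module.End K A) :
    (A × B) →ₗ[K] (A × B) →ₗ[K] (A × B) :=
  LinearMap.mk₂ K
    (fun p q => (μA p.1 q.1 + lB p.2 q.1 + rB q.2 p.1,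
                 μB p.2 q.2 + lA p.1 q.2 + rA q.1 p.2))
    (fun p p' q => by simp [Prod.ext_iff, map_add, LinearMap.add_apply]; constructor <;> abel)
    (fun c p q => by
      simp [Prod.ext_iff, map_smul, LinearMap.smul_apply, smul_add])
    (fun p q q' => by simp [Prod.ext_iff, map_add, LinearMap.add_apply]; constructor <;> abel)
    (fun c p q => by
      simp [Prod.ext_iff, map_smul, LinearMap.smul_apply, smul_add])

theorem mpMul_apply (K : Type*) [Field K] {A B : Type*}
    [AddCommGroup A] [Module K A] [AddCommGroup B] [Module K B]
    (μA : A →ₗ[K] A →ₗ[K] A) (μB : B →ₗ[K] B →ₗ[K] B)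
    (lA rA : A →ₗ[K] Module.End K B) (lB rB : B →ₗ[K] Module.End K A) (p q : A × B) :
    mpMul K μA μB lA rA lB rB p q =
      (μA p.1 q.1 + lB p.2 q.1 + rB q.2 p.1, μB p.2 q.2 + lA p.1 q.2 + rA q.1 p.2) :=
  rfl

/-- given hom-center-symmetric algebras `A`, `B` and mutual bimodules,
`A ⊕ B` with the product `mpMul` and structure map `αA ⊕ αB` is hom-center-symmetric
iff the four matched-pair compatibility conditions (M1)-(M4) hold. -/
theorem matchedPair_iff_hcs_on_sum (K : Type*) [Field K] {A B : Type*}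
    [AddCommGroup A] [Module K A] [AddCommGroup B] [Module K B]
    (μA : A →ₗ[K] A →ₗ[K] A) (αA : A →ₗ[K] A)
    (μB : B →ₗ[K] B →ₗ[K] B) (αB : B →ₗ[K] B)
    (lA rA : A →ₗ[K] Module.End K B) (lB rB : B →ₗ[K] Module.End K A)
    (hA : IsHCS K μA αA) (hB : IsHCS K μB αB)
    (hbA : IsBimodule K μA αA lA rA αB) (hbB : IsBimodule K μB αB lB rB αA) :
    IsHCS K (mpMul K μA μB lA rA lB rB) (αA.prodMap αB) ↔
      ((∀ (x y : A) (a : B),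
          μA (lB a x) (αA y) + lB (rA x a) (αA y) - lB (αB a) (μA x y)
            - rB (αB a) (μA y x) + μA (αA y) (rB a x) + rB (lA x a) (αA y) = 0) ∧
       (∀ (x y : A) (a : B),
          μA (rB a x) (αA y) + lB (lA x a) (αA y) - μA (αA x) (lB a y)
            - rB (rA y a) (αA x) - μA (rB a y) (αA x) - lB (lA y a) (αA x)
            + μA (αA y) (lB a x) + rB (rA x a) (αA y) = 0) ∧
       (∀ (a b : B) (x : A),
          μB (lA x a) (αB b) + lA (rB a x) (αB b) - lA (αA x) (μB a b)
            - rA (αA x) (μB b a) + μB (αB b) (rA x a) + rA (lB a x) (αB b) = 0) ∧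
       (∀ (a b : B) (x : A),
          μB (rA x a) (αB b) + lA (lB a x) (αB b) - μB (αB a) (lA x b)
            - rA (rB b x) (αB a) - μB (rA x b) (αB a) - lA (lB b x) (αB a)
            + μB (αB b) (lA x a) + rA (rB a x) (αB b) = 0)) := by
  obtain ⟨hA₁, hA₂⟩ := hA
  obtain ⟨hB₁, hB₂⟩ := hB
  obtain ⟨hlA, hrA, hAA, hAB⟩ := hbA
  obtain ⟨hlB, hrB, hBB, hBA⟩ := hbB
  simp only [LinearMap.ext_iff, LinearMap.comp_apply, LinearMap.sub_apply]
    at hlA hrA hAA hAB hlB hrB hBB hBA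
  constructor
  · rintro ⟨-, h⟩
    simp only [Prod.forall, mpMul_apply, LinearMap.prodMap_apply, Prod.mk_sub_mk,
      Prod.mk.injEq] at h
    refine ⟨fun x y a => ?_, fun x y a => ?_, fun a b x => ?_, fun a b x => ?_⟩
    · have h₁ := (h 0 a x 0 y 0).1
      simp only [map_zero, LinearMap.zero_apply, add_zero, zero_add] at h₁
      linear_combination (norm := abel) h₁
    · have h₁ := (h x 0 0 a y 0).1
      simp only [map_zero, LinearMap.zero_apply, add_zero, zero_add] at h₁
      linear_combination (norm := abel) h₁
    · have h₁ := (h x 0 0 a 0 b).2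
      simp only [map_zero, LinearMap.zero_apply, add_zero, zero_add] at h₁
      linear_combination (norm := abel) h₁
    · have h₁ := (h 0 a x 0 0 b).2
      simp only [map_zero, LinearMap.zero_apply, add_zero, zero_add] at h₁
      linear_combination (norm := abel) h₁
  · rintro ⟨h₁, h₂, h₃, h₄⟩
    refine ⟨?_, ?_⟩
    · rintro ⟨x, a⟩ ⟨y, b⟩
      simp [mpMul_apply, hA₁, hB₁, hlA, hrA, hlB, hrB]
    · rintro ⟨x, a⟩ ⟨y, b⟩ ⟨z, c⟩
      simp only [mpMul_apply, LinearMap.prodMap_apply, Prod.mk_sub_mk, Prod.mk.injEq,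
        map_add, LinearMap.add_apply]
      constructor
      · linear_combination (norm := abel) hA₂ x y z + h₁ y z a - h₁ y x c + h₂ x z b
          - hBB a b z + hBB c b x - hBA a c y
      · linear_combination (norm := abel) hB₂ a b c + h₃ b c x - h₃ b a z + h₄ a c y
          - hAA x y c + hAA z y a - hAB x z b
end

section
/- Let (A, B, l_A, r_A, l_B, r_B, α_A, α_B) be a matched pair of hom-center-symmetric algebras (A, μ_A, α_A) and (B, μ_B, α_B). Then (G(A)_{α_A}, G(B)_{α_B}, l_A − r_A, l_B − r_B, α_A, α_B) is a matched pair of the sub-adjacent hom-Lie algebras G(A)_{α_A} and G(B)_{α_B}; in particular the two matched-pair relations for hom-Lie algebras hold with ρ_G := l_A − r_A and ρ_H := l_B − r_B. -/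
/-- A matched pair of hom-center-symmetric algebras
`(A, B, lA, rA, lB, rB, αA, αB)`. -/
def IsMatchedPairHCS (K : Type*) [Field K] {A B : Type*}
    [AddCommGroup A] [Module K A] [AddCommGroup B] [Module K B]
    (μA : A →ₗ[K] A →ₗ[K] A) (αA : A →ₗ[K] A)
    (μB : B →ₗ[K] B →ₗ[K] B) (αB : B →ₗ[K] B)
    (lA rA : A →ₗ[K] Module.End K B) (lB rB : B →ₗ[K] Module.End K A) : Prop :=
  IsHCS K μA αA ∧ IsHCS K μB αB ∧
  IsBimodule K μA αA lA rA αB ∧ IsBimodule K μB αB lB rB αA ∧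
  (∀ (x y : A) (a : B),
    μA (lB a x) (αA y) + lB (rA x a) (αA y) - lB (αB a) (μA x y)
      - rB (αB a) (μA y x) + μA (αA y) (rB a x) + rB (lA x a) (αA y) = 0) ∧
  (∀ (x y : A) (a : B),
    μA (rB a x) (αA y) + lB (lA x a) (αA y) - μA (αA x) (lB a y)
      - rB (rA y a) (αA x) - μA (rB a y) (αA x) - lB (lA y a) (αA x)
      + μA (αA y) (lB a x) + rB (rA x a) (αA y) = 0) ∧
  (∀ (a b : B) (x : A),
    μB (lA x a) (αB b) + lA (rB a x) (αB b) - lA (αA x) (μB a b)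
      - rA (αA x) (μB b a) + μB (αB b) (rA x a) + rA (lB a x) (αB b) = 0) ∧
  (∀ (a b : B) (x : A),
    μB (rA x a) (αB b) + lA (lB a x) (αB b) - μB (αB a) (lA x b)
      - rA (rB b x) (αB a) - μB (rA x b) (αB a) - lA (lB b x) (αB a)
      + μB (αB b) (lA x a) + rA (rB a x) (αB b) = 0)

/-- A matched pair of hom-Lie algebras `(G, H, ρG, ρH, φG, φH)`. -/
def IsMatchedPairHomLie (K : Type*) [Field K] {G H : Type*}
    [AddCommGroup G] [Module K G] [AddCommGroup H] [Module K H]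
    (brG : G →ₗ[K] G →ₗ[K] G) (φG : G →ₗ[K] G)
    (brH : H →ₗ[K] H →ₗ[K] H) (φH : H →ₗ[K] H)
    (ρG : G →ₗ[K] Module.End K H) (ρH : H →ₗ[K] Module.End K G) : Prop :=
  IsHomLie K brG φG ∧ IsHomLie K brH φH ∧
  IsHomLieRep K brG φG ρG φH ∧ IsHomLieRep K brH φH ρH φG ∧
  (∀ (x y : G) (a : H),
    ρH (φH a) (brG x y)
      = brG (ρH a x) (φG y) + brG (φG x) (ρH a y)
        + ρH (ρG y a) (φG x) - ρH (ρG x a) (φG y)) ∧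
  (∀ (a b : H) (x : G),
    ρG (φG x) (brH a b)
      = brH (ρG x a) (φH b) + brH (φH a) (ρG x b)
        + ρG (ρH b x) (φH a) - ρG (ρH a x) (φH b))

section

variable {K A V : Type*} [Field K] [AddCommGroup A] [Module K A] [AddCommGroup V] [Module K V]

theorem IsHCS.isHomLie {μ : A →ₗ[K] A →ₗ[K] A} {α : A →ₗ[K] A} (h : IsHCS K μ α) :
    IsHomLie K (μ - μ.flip) α := by
  obtain ⟨hα, hassoc⟩ := h
  refine ⟨fun x y => ?_, fun x y => ?_, fun x y z => ?_⟩
  · simp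
  · simp [hα]
  · simp only [LinearMap.sub_apply, LinearMap.flip_apply, map_sub]
    linear_combination (norm := module) - hassoc x y z - hassoc y z x - hassoc z x y

theorem IsBimodule.isHomLieRep {μ : A →ₗ[K] A →ₗ[K] A} {α : A →ₗ[K] A}
    {l r : A →ₗ[K] Module.End K V} {φ : V →ₗ[K] V} (h : IsBimodule K μ α l r φ) :
    IsHomLieRep K (μ - μ.flip) α (l - r) φ := by
  obtain ⟨hl, hr, hdiag, hmixed⟩ := h
  refine ⟨fun x => ?_, fun x y => ?_⟩
  · simp only [LinearMap.sub_apply, LinearMap.sub_comp, LinearMap.comp_sub, hl, hr]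
  · simp only [LinearMap.sub_apply, LinearMap.flip_apply, map_sub, LinearMap.sub_comp,
      LinearMap.comp_sub]
    linear_combination (norm := module) hdiag y x - hdiag x y + hmixed x y

/-- One of the two compatibility relations of the sub-adjacent matched pair, derived from the
corresponding two relations of the hom-center-symmetric matched pair. -/
theorem sub_adjacent_compatibility {μ : A →ₗ[K] A →ₗ[K] A} {α : A →ₗ[K] A} {β : V →ₗ[K] V}
    {lA rA : A →ₗ[K] Module.End K V} {lV rV : V →ₗ[K] Module.End K A}
    (h₁ : ∀ (x y : A) (a : V),
      μ (lV a x) (α y) + lV (rA x a) (α y) - lV (β a) (μ x y)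
        - rV (β a) (μ y x) + μ (α y) (rV a x) + rV (lA x a) (α y) = 0)
    (h₂ : ∀ (x y : A) (a : V),
      μ (rV a x) (α y) + lV (lA x a) (α y) - μ (α x) (lV a y)
        - rV (rA y a) (α x) - μ (rV a y) (α x) - lV (lA y a) (α x)
        + μ (α y) (lV a x) + rV (rA x a) (α y) = 0) (x y : A) (a : V) :
    (lV - rV) (β a) ((μ - μ.flip) x y)
      = (μ - μ.flip) ((lV - rV) a x) (α y) + (μ - μ.flip) (α x) ((lV - rV) a y)
        + (lV - rV) ((lA - rA) y a) (α x) - (lV - rV) ((lA - rA) x a) (α y) := by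
  simp only [LinearMap.sub_apply, LinearMap.flip_apply, map_sub]
  linear_combination (norm := module) h₁ y x a - h₁ x y a + h₂ x y a

end

/-- a matched pair of hom-center-symmetric algebras induces a matched
pair of the sub-adjacent hom-Lie algebras, via the commutator brackets and the
representations `lA - rA` and `lB - rB`. -/
theorem matchedPairHCS_to_matchedPairHomLie (K : Type*) [Field K] {A B : Type*}
    [AddCommGroup A] [Module K A] [AddCommGroup B] [Module K B]
    (μA : A →ₗ[K] A →ₗ[K] A) (αA : A →ₗ[K] A)
    (μB : B →ₗ[K] B →ₗ[K] B) (αB : B →ₗ[K] B)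
    (lA rA : A →ₗ[K] Module.End K B) (lB rB : B →ₗ[K] Module.End K A)
    (h : IsMatchedPairHCS K μA αA μB αB lA rA lB rB) :
    IsMatchedPairHomLie K (μA - μA.flip) αA (μB - μB.flip) αB (lA - rA) (lB - rB) := by
  obtain ⟨hA, hB, hAB, hBA, hA₁, hA₂, hB₁, hB₂⟩ := h
  exact ⟨hA.isHomLie, hB.isHomLie, hAB.isHomLieRep, hBA.isHomLieRep,
    sub_adjacent_compatibility hA₁ hA₂, sub_adjacent_compatibility hB₁ hB₂⟩
end

section
/- Let (g, [·,·], α) be a hom-Lie algebra over a field K, and let (ρ_U, φ_U, U) and (ρ_V, φ_V, V) be representations of g on K-vector spaces U and V with respect to φ_U and φ_V respectively. Then the linear map x ↦ ρ_U(x) ⊗ φ_V + φ_U ⊗ ρ_V(x), sending u ⊗ v to ρ_U(x)u ⊗ φ_V(v) + φ_U(u) ⊗ ρ_V(x)v, is a representation of g on U ⊗ V with respect to φ_U ⊗ φ_V; that is, for all x, y ∈ g: (ρ_U ⊗ φ_V + φ_U ⊗ ρ_V)(α(x)) ∘ (φ_U ⊗ φ_V) = (φ_U ⊗ φ_V) ∘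 (ρ_U ⊗ φ_V + φ_U ⊗ ρ_V)(x) and (ρ_U ⊗ φ_V + φ_U ⊗ ρ_V)([x,y]) ∘ (φ_U ⊗ φ_V) = (ρ_U ⊗ φ_V + φ_U ⊗ ρ_V)(α(x)) ∘ (ρ_U ⊗ φ_V + φ_U ⊗ ρ_V)(y) − (ρ_U ⊗ φ_V + φ_U ⊗ ρ_V)(α(y)) ∘ (ρ_U ⊗ φ_V + φ_U ⊗ ρ_V)(x). -/
open TensorProduct

/-- given representations `(ρU, φU, U)` and `(ρV, φV, V)` of a hom-Lie
algebra `(g, br, α)`, the map `x ↦ ρU(x) ⊗ φV + φU ⊗ ρV(x)` is a representation of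
`g` on `U ⊗ V` with respect to `φU ⊗ φV`. -/
theorem homLieRep_tensor (K : Type*) [Field K] {g U V : Type*}
    [AddCommGroup g] [Module K g] [AddCommGroup U] [Module K U]
    [AddCommGroup V] [Module K V]
    (br : g →ₗ[K] g →ₗ[K] g) (α : g →ₗ[K] g)
    (ρU : g →ₗ[K] Module.End K U) (φU : U →ₗ[K] U)
    (ρV : g →ₗ[K] Module.End K V) (φV : V →ₗ[K] V)
    (hg : IsHomLie K br α)
    (hU : IsHomLieRep K br α ρU φU) (hV : IsHomLieRep K br α ρV φV) :
    ∃ T : g →ₗ[K] Module.End K (U ⊗[K] V),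
      (∀ (x : g) (u : U) (v : V),
        T x (u ⊗ₜ[K] v) = ρU x u ⊗ₜ[K] φV v + φU u ⊗ₜ[K] ρV x v) ∧
      (∀ x : g, T x = TensorProduct.map (ρU x) φV + TensorProduct.map φU (ρV x)) ∧
      IsHomLieRep K br α T (TensorProduct.map φU φV) := by
  obtain ⟨hU₁, hU₂⟩ := hU
  obtain ⟨hV₁, hV₂⟩ := hV
  refine ⟨(TensorProduct.mapBilinear (.id K) U V U V).flip φV ∘ₗ ρU +
    TensorProduct.mapBilinear (.id K) U V U V φU ∘ₗ ρV,
    fun x u v => rfl, fun x => rfl, fun x => ?_, fun x y => ?_⟩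
  · change (map (ρU (α x)) φV + map φU (ρV (α x))) ∘ₗ map φU φV =
      map φU φV ∘ₗ (map (ρU x) φV + map φU (ρV x))
    simp only [LinearMap.add_comp, LinearMap.comp_add, ← TensorProduct.map_comp, hU₁, hV₁]
  · change (map (ρU (br x y)) φV + map φU (ρV (br x y))) ∘ₗ map φU φV =
      (map (ρU (α x)) φV + map φU (ρV (α x))) ∘ₗ (map (ρU y) φV + map φU (ρV y)) -
      (map (ρU (α y)) φV + map φU (ρV (α y))) ∘ₗ (map (ρU x) φV + map φU (ρV x))
    simp only [LinearMap.add_comp, LinearMap.comp_add, ← TensorProduct.map_comp, hU₁, hV₁,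
      hU₂, hV₂, sub_eq_add_neg, TensorProduct.map_add_left, TensorProduct.map_add_right]
    simp only [← neg_one_smul K (_ ∘ₗ _), TensorProduct.map_smul_left,
      TensorProduct.map_smul_right]
    module
end

section
/- Let (A, ·, α) be a finite-dimensional hom-center-symmetric algebra over a field K and let (A*, ∘, α*) be a hom-center-symmetric algebra structure on its dual space. Define the product ∗ on A ⊕ A* by (x+a) ∗ (y+b) := (x·y + (R_∘(a))*(y) + (L_∘(b))*(x)) + (a∘b + (R_·(x))*(b) + (L_·(y))*(a)), where L_·(x), R_·(x) are left and right multiplications by x for ·, L_∘(a), R_∘(a) those for ∘, and T* denotes the transpose of T. Then the symmetric bilinear form B(x+a, y+b) := ⟨x, b⟩ + ⟨y, a⟩ on A ⊕ A* is invariant for ∗: for all u, v, w ∈ A ⊕ A*, B(u ∗ v, w) = B(u, v ∗ w). -/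
set_option maxSynthPendingDepth 3

/-- Transport of an endomorphism of the dual space `A*` to an endomorphism of `A`
(for finite-dimensional `A`), via the transpose and the canonical identification
`A ≃ A**`; concretely `⟨(conjDD T) x, f⟩ = ⟨x, T f⟩`. -/
noncomputable def conjDD (K : Type*) [Field K] (A : Type*) [AddCommGroup A] [Module K A]
    [FiniteDimensional K A] :
    Module.End K (Module.Dual K A) →ₗ[K] Module.End K A where
  toFun T :=
    ((Module.evalEquiv K A).symm.toLinearMap ∘ₗ Module.Dual.transpose T) ∘ₗ
      (Module.evalEquiv K A).toLinearMap
  map_add' T S := by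
    simp [map_add, LinearMap.add_comp, LinearMap.comp_add]
  map_smul' c T := by
    simp [map_smul, LinearMap.smul_comp, LinearMap.comp_smul]

/-- The product `∗` on `A ⊕ A*`:
`(x+a) ∗ (y+b) = (x·y + (R∘ a)* y + (L∘ b)* x) + (a∘b + (R· x)* b + (L· y)* a)`. -/
noncomputable def doubleMul (K : Type*) [Field K] (A : Type*) [AddCommGroup A] [Module K A]
    [FiniteDimensional K A]
    (μ : A →ₗ[K] A →ₗ[K] A)
    (ν : Module.Dual K A →ₗ[K] Module.Dual K A →ₗ[K] Module.Dual K A)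
    (p q : A × Module.Dual K A) : A × Module.Dual K A :=
  (μ p.1 q.1 + conjDD K A (ν.flip p.2) q.1 + conjDD K A (ν q.2) p.1,
   ν p.2 q.2 + (μ.flip p.1).dualMap q.2 + (μ q.1).dualMap p.2)

/-- The standard symmetric bilinear form `B(x+a, y+b) = ⟨x, b⟩ + ⟨y, a⟩` on `A ⊕ A*`. -/
def standardForm (K : Type*) [Field K] (A : Type*) [AddCommGroup A] [Module K A]
    (p q : A × Module.Dual K A) : K :=
  q.2 p.1 + p.2 q.1

/-- The defining pairing of `conjDD`: `⟨(conjDD T) x, f⟩ = ⟨x, T f⟩`. -/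
theorem apply_conjDD (K : Type*) [Field K] (A : Type*) [AddCommGroup A] [Module K A]
    [FiniteDimensional K A] (T : Module.End K (Module.Dual K A)) (x : A)
    (f : Module.Dual K A) : f (conjDD K A T x) = T f x := by
  change f ((Module.evalEquiv K A).symm _) = _
  rw [Module.apply_evalEquiv_symm_apply]
  rfl

/-- the standard symmetric bilinear form on `A ⊕ A*` is invariant for
the product `∗` built from a hom-center-symmetric algebra `(A, ·, α)` and a
hom-center-symmetric structure `(A*, ∘, α*)` on its dual. -/
theorem standardForm_invariant (K : Type*) [Field K] (A : Type*)
    [AddCommGroup A] [Module K A] [FiniteDimensional K A]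
    (μ : A →ₗ[K] A →ₗ[K] A) (α : A →ₗ[K] A)
    (ν : Module.Dual K A →ₗ[K] Module.Dual K A →ₗ[K] Module.Dual K A)
    (hμ : IsHCS K μ α) (hν : IsHCS K ν α.dualMap) :
    ∀ u v w : A × Module.Dual K A,
      standardForm K A (doubleMul K A μ ν u v) w
        = standardForm K A u (doubleMul K A μ ν v w) := by
  rintro ⟨x, a⟩ ⟨y, b⟩ ⟨z, c⟩
  simp only [standardForm, doubleMul, map_add, LinearMap.add_apply, apply_conjDD,
    LinearMap.flip_apply, LinearMap.dualMap_apply]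
  ring
end
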